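/- Let z = (z_Q, z_RD, z_RC) be a fluid solution whose initial state has all three components nonnegative. Then for all t ≥ 0, the total fluid mass satisfies z_Q(t) + z_RD(t) + z_RC(t) ≤ z_Q(0) + z_RD(0) + z_RC(0) + λ·t. (Deterministic analogue of the compact-containment bound used in the proof of Lemma 1: only fresh input at rate λ can increase the total content.) -/

import Mathlib

/-- The fluid drift map of the call-center fluid model with redials and reconnects. -/
noncomputable def fluidDrift (lam s mu th p q dRD dRC : ℝ) :
    ℝ × ℝ × ℝ → ℝ × ℝ × ℝ :=
  fun z =>
    (lam + dRD * z.2.1 + dRC * z.2.2 - mu * min s z.1 - th * max (z.1 - s) 0,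
     p * th * max (z.1 - s) 0 - dRD * z.2.1,
     q * mu * min s z.1 - dRC * z.2.2)

/-- A fluid solution: a function continuous on `[0, ∞)` satisfying the integral equation
`z(t) = z(0) + ∫₀ᵗ H(z(u)) du` for all `t ≥ 0`. -/
def IsFluidSolution (lam s mu th p q dRD dRC : ℝ) (z : ℝ → ℝ × ℝ × ℝ) : Prop :=
  ContinuousOn z (Set.Ici 0) ∧
    ∀ t : ℝ, 0 ≤ t →
      z t = z 0 + ∫ u in (0:ℝ)..t, fluidDrift lam s mu th p q dRD dRC (z u)

theorem hasDerivAt_min_zero_sq (x : ℝ) :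
    HasDerivAt (fun y : ℝ => (min y 0) ^ 2) (2 * min x 0) x := by
  rcases lt_trichotomy x 0 with hx | rfl | hx
  · rw [min_eq_left hx.le]
    have h : HasDerivAt (fun y : ℝ => y ^ 2) (2 * x) x := by
      simpa using hasDerivAt_pow 2 x
    refine h.congr_of_eventuallyEq ?_
    filter_upwards [Iio_mem_nhds hx] with y hy
    rw [min_eq_left (le_of_lt hy)]
  · rw [hasDerivAt_iff_isLittleO]
    have h : (fun y : ℝ => y ^ 2) =o[nhds 0] fun y : ℝ => y :=
      Asymptotics.isLittleO_pow_id one_lt_two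
    simp only [min_self, mul_zero, smul_eq_mul, sub_zero, ne_eq, OfNat.ofNat_ne_zero,
      not_false_eq_true, zero_pow]
    refine (Asymptotics.IsBigO.of_bound 1
      (Filter.Eventually.of_forall fun y => ?_)).trans_isLittleO h
    rw [one_mul, Real.norm_of_nonneg (sq_nonneg _), Real.norm_of_nonneg (sq_nonneg _)]
    rcases le_total y 0 with hy | hy
    · rw [min_eq_left hy]
    · rw [min_eq_right hy]
      nlinarith [sq_nonneg y]
  · rw [min_eq_right hx.le]
    have h : HasDerivAt (fun _ : ℝ => (0 : ℝ)) (2 * 0) x := by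
      simpa using hasDerivAt_const x (0 : ℝ)
    refine h.congr_of_eventuallyEq ?_
    filter_upwards [Ioi_mem_nhds hx] with y hy
    rw [min_eq_right (Set.mem_Ioi.mp hy).le]
    norm_num

theorem continuous_fluidDrift (lam s mu th p q dRD dRC : ℝ) :
    Continuous (fluidDrift lam s mu th p q dRD dRC) := by
  unfold fluidDrift
  fun_prop

/-- A fluid solution agrees on `[0, ∞)` with a function that solves the fluid differential
equation there in the two-sided sense. -/
theorem IsFluidSolution.exists_hasDerivAt {lam s mu th p q dRD dRC : ℝ} {z : ℝ → ℝ × ℝ × ℝ}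
    (hz : IsFluidSolution lam s mu th p q dRD dRC z) :
    ∃ y : ℝ → ℝ × ℝ × ℝ, (∀ t, 0 ≤ t → y t = z t) ∧
      ∀ t, 0 ≤ t → HasDerivAt y (fluidDrift lam s mu th p q dRD dRC (y t)) t := by
  obtain ⟨hc, hi⟩ := hz
  set g : ℝ → ℝ × ℝ × ℝ := fun u => fluidDrift lam s mu th p q dRD dRC (z (max u 0)) with hg
  have hgc : Continuous g :=
    (continuous_fluidDrift lam s mu th p q dRD dRC).comp
      (hc.comp_continuous (by fun_prop) fun u => le_max_right u 0)
  have hy : ∀ t, 0 ≤ t → (z 0 + ∫ u in (0:ℝ)..t, g u) = z t := by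
    intro t ht
    rw [hi t ht]
    congr 1
    refine intervalIntegral.integral_congr fun u hu => ?_
    rw [Set.uIcc_of_le ht] at hu
    simp only [hg, max_eq_left hu.1]
  refine ⟨fun t => z 0 + ∫ u in (0:ℝ)..t, g u, hy, fun t ht => ?_⟩
  have hd := (hgc.integral_hasStrictDerivAt 0 t).hasDerivAt.const_add (z 0)
  have hgt : g t = fluidDrift lam s mu th p q dRD dRC (z 0 + ∫ u in (0:ℝ)..t, g u) := by
    rw [hy t ht]
    simp only [hg, max_eq_left ht]
  rw [← hgt]
  exact hd

/-- The drift points, up to a linear error, into the nonnegative orthant. -/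
theorem fluidDrift_negPart_bound {lam s mu th p q dRD dRC : ℝ}
    (hlam : 0 ≤ lam) (hs : 0 < s) (hmu : 0 < mu) (hth : 0 < th)
    (hp0 : 0 ≤ p) (hq0 : 0 ≤ q) (hdRD : 0 < dRD) (hdRC : 0 < dRC) (w : ℝ × ℝ × ℝ) :
    2 * min w.1 0 * (fluidDrift lam s mu th p q dRD dRC w).1
      + 2 * min w.2.1 0 * (fluidDrift lam s mu th p q dRD dRC w).2.1
      + 2 * min w.2.2 0 * (fluidDrift lam s mu th p q dRD dRC w).2.2
      ≤ 2 * (dRD + dRC + q * mu) *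
        ((min w.1 0) ^ 2 + (min w.2.1 0) ^ 2 + (min w.2.2 0) ^ 2) := by
  obtain ⟨x, y, v⟩ := w
  simp only [fluidDrift]
  set a := min x 0 with ha
  set b := min y 0 with hb
  set c := min v 0 with hc
  have ha0 : a ≤ 0 := min_le_right _ _
  have hb0 : b ≤ 0 := min_le_right _ _
  have hc0 : c ≤ 0 := min_le_right _ _
  have hby : b ≤ y := min_le_left _ _
  have hcv : c ≤ v := min_le_left _ _
  have hbb : b * y = b ^ 2 := by
    rcases le_total y 0 with h | h
    · rw [hb, min_eq_left h]; ring
    · rw [hb, min_eq_right h]; ring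
  have hcc : c * v = c ^ 2 := by
    rcases le_total v 0 with h | h
    · rw [hc, min_eq_left h]; ring
    · rw [hc, min_eq_right h]; ring
  have ham : a * min s x = a ^ 2 := by
    rcases le_total x 0 with h | h
    · rw [ha, min_eq_left h, min_eq_right (h.trans hs.le)]; ring
    · rw [ha, min_eq_right h]; ring
  have hax : a * max (x - s) 0 = 0 := by
    rcases le_total x 0 with h | h
    · rw [max_eq_right (by linarith), mul_zero]
    · rw [ha, min_eq_right h, zero_mul]
  have hms : a ≤ min s x := le_min (ha0.trans hs.le) (min_le_left _ _)
  have hM : 0 ≤ max (x - s) 0 := le_max_right _ _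
  have hqm : 0 ≤ q * mu := mul_nonneg hq0 hmu.le
  have e1 : a * (lam + dRD * y + dRC * v - mu * min s x - th * max (x - s) 0)
      ≤ dRD * (a * b) + dRC * (a * c) := by
    have h1 : a * lam ≤ 0 := mul_nonpos_of_nonpos_of_nonneg ha0 hlam
    have h2 : dRD * (a * y) ≤ dRD * (a * b) :=
      mul_le_mul_of_nonneg_left (mul_le_mul_of_nonpos_left hby ha0) hdRD.le
    have h3 : dRC * (a * v) ≤ dRC * (a * c) :=
      mul_le_mul_of_nonneg_left (mul_le_mul_of_nonpos_left hcv ha0) hdRC.le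
    have h4 : 0 ≤ mu * a ^ 2 := by positivity
    linear_combination h1 + h2 + h3 + h4 - mu * ham - th * hax
  have e2 : b * (p * th * max (x - s) 0 - dRD * y) ≤ 0 := by
    have h1 : b * (p * th * max (x - s) 0) ≤ 0 :=
      mul_nonpos_of_nonpos_of_nonneg hb0 (by positivity)
    have h2 : 0 ≤ dRD * b ^ 2 := by positivity
    linear_combination h1 + h2 - dRD * hbb
  have e3 : c * (q * mu * min s x - dRC * v) ≤ q * mu * (a * c) := by
    have h1 : q * mu * (c * min s x) ≤ q * mu * (c * a) :=
      mul_le_mul_of_nonneg_left (mul_le_mul_of_nonpos_left hms hc0) hqm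
    have h2 : 0 ≤ dRC * c ^ 2 := by positivity
    linear_combination h1 + h2 - dRC * hcc
  have f1 : dRD * (2 * (a * b)) ≤ dRD * (2 * (a ^ 2 + b ^ 2 + c ^ 2)) :=
    mul_le_mul_of_nonneg_left
      (by nlinarith [sq_nonneg (a - b), sq_nonneg a, sq_nonneg b, sq_nonneg c]) hdRD.le
  have f2 : (dRC + q * mu) * (2 * (a * c)) ≤ (dRC + q * mu) * (2 * (a ^ 2 + b ^ 2 + c ^ 2)) :=
    mul_le_mul_of_nonneg_left
      (by nlinarith [sq_nonneg (a - c), sq_nonneg a, sq_nonneg b, sq_nonneg c])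
      (by positivity)
  linear_combination 2 * e1 + 2 * e2 + 2 * e3 + f1 + f2

/-- A function whose derivative on `[0, ∞)` is nonpositive stays below its initial value. -/
theorem le_initial_of_hasDerivAt_nonpos {f f' : ℝ → ℝ}
    (hf : ∀ t, 0 ≤ t → HasDerivAt f (f' t) t) (hf' : ∀ t, 0 ≤ t → f' t ≤ 0)
    {t : ℝ} (ht : 0 ≤ t) : f t ≤ f 0 := by
  have hanti : AntitoneOn f (Set.Ici 0) := by
    refine antitoneOn_of_deriv_nonpos (convex_Ici 0)
      (fun x hx => (hf x hx).continuousAt.continuousWithinAt)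
      (fun x hx => (hf x (interior_subset hx)).differentiableAt.differentiableWithinAt)
      fun x hx => ?_
    rw [(hf x (interior_subset hx)).deriv]
    exact hf' x (interior_subset hx)
  exact hanti Set.self_mem_Ici ht ht

/-- the total fluid mass grows at most linearly at rate λ. -/
theorem fluid_solution_total_mass_bound (lam s mu th p q dRD dRC : ℝ)
    (hlam : 0 ≤ lam) (hs : 0 < s) (hmu : 0 < mu) (hth : 0 < th)
    (hp0 : 0 ≤ p) (hp1 : p ≤ 1) (hq0 : 0 ≤ q) (hq1 : q < 1)
    (hdRD : 0 < dRD) (hdRC : 0 < dRC) (z : ℝ → ℝ × ℝ × ℝ)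
    (hz : IsFluidSolution lam s mu th p q dRD dRC z)
    (hQ0 : 0 ≤ (z 0).1) (hRD0 : 0 ≤ (z 0).2.1) (hRC0 : 0 ≤ (z 0).2.2) :
    ∀ t : ℝ, 0 ≤ t →
      (z t).1 + (z t).2.1 + (z t).2.2 ≤ (z 0).1 + (z 0).2.1 + (z 0).2.2 + lam * t := by
  obtain ⟨y, hyz, hy⟩ := hz.exists_hasDerivAt
  have h1 : ∀ t, 0 ≤ t → HasDerivAt (fun t => (y t).1)
      (fluidDrift lam s mu th p q dRD dRC (y t)).1 t := fun t ht =>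
    (ContinuousLinearMap.fst ℝ ℝ (ℝ × ℝ)).hasFDerivAt.comp_hasDerivAt t (hy t ht)
  have h2' : ∀ t, 0 ≤ t → HasDerivAt (fun t => (y t).2)
      (fluidDrift lam s mu th p q dRD dRC (y t)).2 t := fun t ht =>
    (ContinuousLinearMap.snd ℝ ℝ (ℝ × ℝ)).hasFDerivAt.comp_hasDerivAt t (hy t ht)
  have h2 : ∀ t, 0 ≤ t → HasDerivAt (fun t => (y t).2.1)
      (fluidDrift lam s mu th p q dRD dRC (y t)).2.1 t := fun t ht =>
    (ContinuousLinearMap.fst ℝ ℝ ℝ).hasFDerivAt.comp_hasDerivAt t (h2' t ht)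
  have h3 : ∀ t, 0 ≤ t → HasDerivAt (fun t => (y t).2.2)
      (fluidDrift lam s mu th p q dRD dRC (y t)).2.2 t := fun t ht =>
    (ContinuousLinearMap.snd ℝ ℝ ℝ).hasFDerivAt.comp_hasDerivAt t (h2' t ht)
  have hy0 := hyz 0 le_rfl
  have hnonneg : ∀ t, 0 ≤ t → 0 ≤ (y t).1 := by
    intro t ht
    set C := 2 * (dRD + dRC + q * mu) with hC
    set V : ℝ → ℝ := fun t =>
      (min (y t).1 0) ^ 2 + (min (y t).2.1 0) ^ 2 + (min (y t).2.2 0) ^ 2 with hV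
    set D : ℝ → ℝ := fun t =>
      2 * min (y t).1 0 * (fluidDrift lam s mu th p q dRD dRC (y t)).1
      + 2 * min (y t).2.1 0 * (fluidDrift lam s mu th p q dRD dRC (y t)).2.1
      + 2 * min (y t).2.2 0 * (fluidDrift lam s mu th p q dRD dRC (y t)).2.2 with hD
    have hVd : ∀ t, 0 ≤ t → HasDerivAt V (D t) t := fun t ht =>
      (((hasDerivAt_min_zero_sq _).comp t (h1 t ht)).add
        ((hasDerivAt_min_zero_sq _).comp t (h2 t ht))).add
        ((hasDerivAt_min_zero_sq _).comp t (h3 t ht))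
    have hE : ∀ t, HasDerivAt (fun t : ℝ => Real.exp (-C * t)) (Real.exp (-C * t) * -C) t :=
      fun t => by simpa using ((hasDerivAt_id t).const_mul (-C)).exp
    have hle := le_initial_of_hasDerivAt_nonpos
      (fun t ht => (hVd t ht).mul (hE t)) (fun t _ => by
        have hb : D t ≤ C * V t :=
          fluidDrift_negPart_bound hlam hs hmu hth hp0 hq0 hdRD hdRC (y t)
        have := mul_le_mul_of_nonneg_right hb (Real.exp_pos (-C * t)).le
        linarith) ht
    have hV0 : V 0 = 0 := by
      simp only [hV, hy0, min_eq_right hQ0, min_eq_right hRD0, min_eq_right hRC0]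
      norm_num
    have hVt : V t ≤ 0 := by
      simp only [Pi.mul_apply, hV0, zero_mul] at hle
      exact nonpos_of_mul_nonpos_left hle (Real.exp_pos _)
    by_contra! hneg
    have hm : min (y t).1 0 = (y t).1 := min_eq_left hneg.le
    simp only [hV, hm] at hVt
    nlinarith [sq_nonneg (min (y t).2.1 0), sq_nonneg (min (y t).2.2 0)]
  intro t ht
  have hle := le_initial_of_hasDerivAt_nonpos
    (fun t ht => (((h1 t ht).add (h2 t ht)).add (h3 t ht)).sub
      ((hasDerivAt_id t).const_mul lam)) (fun t ht => by
      have hm : 0 ≤ min s (y t).1 := le_min hs.le (hnonneg t ht)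
      have hM : 0 ≤ max ((y t).1 - s) 0 := le_max_right _ _
      have e1 : 0 ≤ (1 - q) * (mu * min s (y t).1) :=
        mul_nonneg (by linarith) (by positivity)
      have e2 : 0 ≤ (1 - p) * (th * max ((y t).1 - s) 0) :=
        mul_nonneg (by linarith) (by positivity)
      simp only [fluidDrift]
      linarith) ht
  simp only [Pi.sub_apply, Pi.add_apply, id, mul_zero, hyz t ht, hy0] at hle
  linarith
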